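/- arXiv:1704.07608 — 2 statements merged into one kernel-verified Lean document; each statement's English description precedes it below -/
import Mathlib

section
/- Let k be an algebraically closed field of characteristic p > 0, let V be a finite-dimensional k-vector space, and let F : V → V be a Frobenius-semilinear endomorphism. Then V admits an internal direct sum decomposition V = V_s ⊕ V_n into F-invariant k-subspaces V_s and V_n such that the restriction of F to V_s is bijective and F is nilpotent on V_n, i.e. some iterate F^N vanishes identically on V_n. -/
/-- **Fitting decomposition for a Frobenius-semilinear endomorphism.**
Let `k` be an algebraically closed field of characteristic `p > 0`, `V` a
finite-dimensional `k`-vector space and `F : V → V` an additive map satisfying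
`F (c • v) = c ^ p • F v` (a Frobenius-semilinear endomorphism).  Then `V`
decomposes as an internal direct sum `V = V_s ⊕ V_n` of `F`-invariant
subspaces such that `F` restricts to a bijection of `V_s` and some iterate of
`F` vanishes identically on `V_n`. -/
theorem frobenius_semilinear_fitting_decomposition
    (k : Type*) [Field k] [IsAlgClosed k] (p : ℕ) [hp : Fact p.Prime]
    [CharP k p]
    (V : Type*) [AddCommGroup V] [Module k V] [FiniteDimensional k V]
    (F : V → V)
    (hadd : ∀ x y : V, F (x + y) = F x + F y)
    (hsmul : ∀ (c : k) (v : V), F (c • v) = c ^ p • F v) :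
    ∃ Vs Vn : Submodule k V, IsCompl Vs Vn ∧
      (∀ v ∈ Vs, F v ∈ Vs) ∧ (∀ v ∈ Vn, F v ∈ Vn) ∧
      Set.BijOn F (Vs : Set V) (Vs : Set V) ∧
      ∃ N : ℕ, ∀ v ∈ Vn, F^[N] v = 0 := by
  have hp0 : 0 < p := hp.out.pos
  have iadd : ∀ (n : ℕ) (x y : V), F^[n] (x + y) = F^[n] x + F^[n] y := by
    intro n
    induction n with
    | zero => intro x y; rfl
    | succ n ih => intro x y; simp only [Function.iterate_succ_apply, hadd, ih]
  have ismul : ∀ (n : ℕ) (c : k) (x : V), F^[n] (c • x) = c ^ (p ^ n) • F^[n] x := by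
    intro n
    induction n with
    | zero => intro c x; simp
    | succ n ih =>
      intro c x
      simp only [Function.iterate_succ_apply, hsmul, ih, ← pow_mul, pow_succ']
  have izero : ∀ n : ℕ, F^[n] 0 = 0 := by
    intro n
    have h := iadd n 0 0
    rw [add_zero] at h
    exact left_eq_add.mp h
  have F0 : F 0 = 0 := izero 1
  let K : ℕ → Submodule k V := fun n =>
    { carrier := {v | F^[n] v = 0}
      add_mem' := by
        intro a b ha hb
        simp only [Set.mem_setOf_eq] at ha hb ⊢
        rw [iadd, ha, hb, add_zero]
      zero_mem' := izero n
      smul_mem' := by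
        intro c x hx
        simp only [Set.mem_setOf_eq] at hx ⊢
        rw [ismul, hx, smul_zero] }
  let R : ℕ → Submodule k V := fun n =>
    { carrier := {v | ∃ w, F^[n] w = v}
      add_mem' := by
        rintro _ _ ⟨a, rfl⟩ ⟨b, rfl⟩
        exact ⟨a + b, iadd n a b⟩
      zero_mem' := ⟨0, izero n⟩
      smul_mem' := by
        rintro c _ ⟨a, rfl⟩
        obtain ⟨z, hz⟩ := IsAlgClosed.exists_pow_nat_eq c (pow_pos hp0 n)
        exact ⟨z • a, by rw [ismul, hz]⟩ }
  have memK : ∀ n v, v ∈ K n ↔ F^[n] v = 0 := fun n v => Iff.rfl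
  have memR : ∀ n v, v ∈ R n ↔ ∃ w, F^[n] w = v := fun n v => Iff.rfl
  have Kmono : Monotone K := by
    refine monotone_nat_of_le_succ fun n v hv => ?_
    rw [memK] at hv ⊢
    rw [Function.iterate_succ_apply', hv, F0]
  have Ranti : Antitone R := by
    refine antitone_nat_of_succ_le fun n v hv => ?_
    rw [memR] at hv ⊢
    obtain ⟨w, rfl⟩ := hv
    exact ⟨F w, (Function.iterate_succ_apply F n w).symm⟩
  obtain ⟨a, ha⟩ := monotone_stabilizes_iff_noetherian.mpr
    (inferInstance : IsNoetherian k V) ⟨K, Kmono⟩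
  obtain ⟨b, hb⟩ := IsArtinian.monotone_stabilizes (R := k) (M := V)
    ⟨fun n => OrderDual.toDual (R n), fun i j h => Ranti h⟩
  have hK : ∀ m, a ≤ m → K a = K m := ha
  have hR : ∀ m, b ≤ m → R b = R m := hb
  obtain ⟨N, hNa, hNb⟩ : ∃ N, a ≤ N ∧ b ≤ N := ⟨max a b, le_max_left _ _, le_max_right _ _⟩
  have hK' : ∀ m, N ≤ m → K m = K N := fun m h =>
    (hK m (hNa.trans h)).symm.trans (hK N hNa)
  have hR' : ∀ m, N ≤ m → R m = R N := fun m h =>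
    (hR m (hNb.trans h)).symm.trans (hR N hNb)
  have hdisj : ∀ v, v ∈ R N → v ∈ K N → v = 0 := by
    rintro v ⟨w, rfl⟩ hv
    have hw : w ∈ K (N + N) := by
      rw [memK, Function.iterate_add_apply]
      exact hv
    rw [hK' _ (Nat.le_add_left N N)] at hw
    exact hw
  have hRF : ∀ v ∈ R N, F v ∈ R N := by
    rintro v ⟨w, rfl⟩
    exact ⟨F w, by rw [← Function.iterate_succ_apply, Function.iterate_succ_apply']⟩
  refine ⟨R N, K N, ⟨?_, ?_⟩, hRF, ?_, ⟨hRF, ?_, ?_⟩, N, fun v hv => hv⟩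
  · rw [Submodule.disjoint_def]
    exact hdisj
  · rw [codisjoint_iff, Submodule.eq_top_iff']
    intro v
    have h1 : F^[N] v ∈ R (N + N) := by
      rw [hR' _ (Nat.le_add_left N N)]
      exact ⟨v, rfl⟩
    obtain ⟨w, hw⟩ := h1
    rw [Function.iterate_add_apply] at hw
    refine Submodule.mem_sup.mpr ⟨F^[N] w, ⟨w, rfl⟩, v - F^[N] w, ?_, by abel⟩
    rw [memK]
    have h2 := iadd N (v - F^[N] w) (F^[N] w)
    rw [sub_add_cancel, hw] at h2
    exact right_eq_add.mp h2
  · intro v hv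
    rw [memK] at hv ⊢
    rw [← Function.iterate_succ_apply, Function.iterate_succ_apply', hv, F0]
  · intro x hx y hy hxy
    have hxy' : x - y ∈ R N := (R N).sub_mem hx hy
    have h2 := hadd (x - y) y
    rw [sub_add_cancel, hxy] at h2
    have h3 : F (x - y) = 0 := right_eq_add.mp h2
    have h4 : x - y ∈ K (N + 1) := by
      rw [memK, Function.iterate_succ_apply, h3, izero]
    rw [hK' _ (Nat.le_succ N)] at h4
    exact sub_eq_zero.mp (hdisj _ hxy' h4)
  · intro v hv
    have h1 : v ∈ R (N + 1) := by
      rw [hR' _ (Nat.le_succ N)]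
      exact hv
    obtain ⟨w, rfl⟩ := h1
    exact ⟨F^[N] w, ⟨w, rfl⟩, (Function.iterate_succ_apply' F N w).symm⟩
end

section
/- Let k be a field and let R = k[[a,b]]/(ab). Let σ be a k-algebra automorphism of R and let μ, ν ∈ k^× be such that either (σ(a) = μ·a and σ(b) = ν·b) or (σ(a) = μ·b and σ(b) = ν·a), where a, b denote the images of the variables in R. Then μν = 1 if and only if there exists a k-algebra automorphism σ~ of the power series ring k[[a,b]] that lifts σ (i.e. is compatible with σ via the quotient map k[[a,b]] → R) and satisfies σ~(ab) = ab. -/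
/-- The ideal `(ab)` of the formal power series ring `k[[a,b]]`
(with `a = X 0` and `b = X 1`). -/
noncomputable def nodeIdeal (k : Type*) [Field k] : Ideal (MvPowerSeries (Fin 2) k) :=
  Ideal.span {(MvPowerSeries.X 0 : MvPowerSeries (Fin 2) k) * MvPowerSeries.X 1}

lemma node_mul_mem_pow {R : Type*} [CommRing R] (J : Ideal R) (n : ℕ) {y w : R}
    (hy : y ∈ J) (hw : w ∈ J ^ n) : y * w ∈ J ^ (n + 1) := by
  rw [pow_succ']
  exact Ideal.mul_mem_mul hy hw

open MvPowerSeries in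
/-- Every power series is `c + a u + b v`. -/
lemma node_decomp {k : Type*} [Field k] (x : MvPowerSeries (Fin 2) k) :
    ∃ (c : k) (u v : MvPowerSeries (Fin 2) k),
      x = algebraMap k _ c + X 0 * u + X 1 * v := by
  let g : MvPowerSeries (Fin 2) k := fun m => if m 0 = 0 then coeff m x else 0
  have hg : ∀ m, coeff m g = if m 0 = 0 then coeff m x else 0 := fun m => rfl
  have h0 : (X 0 : MvPowerSeries (Fin 2) k) ∣ x - g := by
    rw [X_dvd_iff]
    intro m hm
    simp [hg, hm]
  have h1 : (X 1 : MvPowerSeries (Fin 2) k) ∣ g - C (constantCoeff x) := by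
    classical
    rw [X_dvd_iff]
    intro m hm
    rw [map_sub, hg, coeff_C]
    by_cases h : m 0 = 0
    · have : m = 0 := by
        ext i
        fin_cases i <;> simp [h, hm]
      subst this
      simp
    · have : m ≠ 0 := by
        rintro rfl
        simp at h
      simp [h, this]
  obtain ⟨u, hu⟩ := h0
  obtain ⟨v, hv⟩ := h1
  refine ⟨constantCoeff x, u, v, ?_⟩
  rw [← hu, ← hv, ← c_eq_algebraMap]
  ring

open MvPowerSeries in
/-- Algebra maps from `k[[a,b]]` to the node are determined by the images of `a`, `b`, if these
have zero constant term. -/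
lemma node_hom_ext {k : Type*} [Field k]
    (φ ψ : MvPowerSeries (Fin 2) k →ₐ[k] (MvPowerSeries (Fin 2) k ⧸ nodeIdeal k))
    (y z : MvPowerSeries (Fin 2) k) (hy : constantCoeff y = 0) (hz : constantCoeff z = 0)
    (hφ0 : φ (X 0) = Ideal.Quotient.mk _ y) (hφ1 : φ (X 1) = Ideal.Quotient.mk _ z)
    (hψ0 : ψ (X 0) = Ideal.Quotient.mk _ y) (hψ1 : ψ (X 1) = Ideal.Quotient.mk _ z)
    (x : MvPowerSeries (Fin 2) k) : φ x = ψ x := by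
  let ε : (MvPowerSeries (Fin 2) k ⧸ nodeIdeal k) →+* k :=
    Ideal.Quotient.lift (nodeIdeal k) constantCoeff (by
      intro a ha
      obtain ⟨c, rfl⟩ := Ideal.mem_span_singleton.1 ha
      simp)
  have : Nontrivial (MvPowerSeries (Fin 2) k ⧸ nodeIdeal k) := ε.domain_nontrivial
  have : IsLocalRing (MvPowerSeries (Fin 2) k ⧸ nodeIdeal k) :=
    IsLocalRing.of_surjective' (Ideal.Quotient.mk _) Ideal.Quotient.mk_surjective
  have key : ∀ n : ℕ, ∀ x, φ x - ψ x ∈ RingHom.ker ε ^ n := by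
    intro n
    induction n with
    | zero => simp
    | succ n ih =>
      intro x
      obtain ⟨c, u, v, rfl⟩ := node_decomp x
      have e : φ (algebraMap k _ c + X 0 * u + X 1 * v)
          - ψ (algebraMap k _ c + X 0 * u + X 1 * v)
          = Ideal.Quotient.mk _ y * (φ u - ψ u) + Ideal.Quotient.mk _ z * (φ v - ψ v) := by
        simp only [map_add, map_mul, AlgHom.commutes, hφ0, hφ1, hψ0, hψ1]
        ring
      rw [e]
      refine add_mem (node_mul_mem_pow _ n ?_ (ih u)) (node_mul_mem_pow _ n ?_ (ih v))
      · simp [ε, RingHom.mem_ker, hy]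
      · simp [ε, RingHom.mem_ker, hz]
  have h := Ideal.iInf_pow_eq_bot_of_isLocalRing (RingHom.ker ε) (RingHom.ker_ne_top ε)
  have hm : φ x - ψ x ∈ ⨅ i : ℕ, RingHom.ker ε ^ i := by
    rw [Submodule.mem_iInf]
    exact fun n => key n x
  rw [h] at hm
  exact sub_eq_zero.1 (by simpa using hm)

open MvPowerSeries in
/-- The diagonal automorphism. -/
lemma node_diag {k : Type*} [Field k] (μ ν : kˣ) :
    ∃ τ : MvPowerSeries (Fin 2) k ≃ₐ[k] MvPowerSeries (Fin 2) k,
      τ (X 0) = (μ : k) • X 0 ∧ τ (X 1) = (ν : k) • X 1 := by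
  have hX : ∀ (a : Fin 2 → k) (i : Fin 2),
      rescaleAlgHom a (X i : MvPowerSeries (Fin 2) k) = a i • X i := by
    intro a i
    rw [rescaleAlgHom, substAlgHom_X]
    rfl
  refine ⟨AlgEquiv.ofAlgHom (rescaleAlgHom ![(μ : k), ν])
    (rescaleAlgHom ![((μ⁻¹ : kˣ) : k), ((ν⁻¹ : kˣ) : k)]) ?_ ?_, ?_, ?_⟩
  · rw [← rescaleAlgHom_mul, ← rescaleAlgHom_one]
    congr 1
    ext i
    fin_cases i <;> simp
  · rw [← rescaleAlgHom_mul, ← rescaleAlgHom_one]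
    congr 1
    ext i
    fin_cases i <;> simp
  · simp [hX]
  · simp [hX]

open MvPowerSeries in
lemma node_lift_eq {k : Type*} [Field k] (x y : MvPowerSeries (Fin 2) k)
    (h : Ideal.Quotient.mkₐ k (nodeIdeal k) x = Ideal.Quotient.mkₐ k (nodeIdeal k) y) :
    ∃ f, x = y + X 0 * X 1 * f := by
  have h' : x - y ∈ nodeIdeal k := Ideal.Quotient.eq.1 h
  obtain ⟨f, hf⟩ := Ideal.mem_span_singleton.1 h'
  exact ⟨f, by rw [← hf]; ring⟩

lemma node_X_ne_zero {k : Type*} [Field k] (i : Fin 2) :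
    (MvPowerSeries.X i : MvPowerSeries (Fin 2) k) ≠ 0 := by
  intro h
  have := congrArg (MvPowerSeries.coeff (Finsupp.single i 1)) h
  simp at this

/-- Let `k` be a field and `R = k[[a,b]]/(ab)`.  Let `σ` be a `k`-algebra
automorphism of `R` and `μ, ν ∈ k^×` such that either `σ(a) = μ·a, σ(b) = ν·b`
or `σ(a) = μ·b, σ(b) = ν·a`.  Then `μν = 1` if and only if `σ` lifts to a
`k`-algebra automorphism `τ` of `k[[a,b]]` (compatible with `σ` via the
quotient map) satisfying `τ(ab) = ab`. -/
theorem node_automorphism_lifts_iff_det_one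
    (k : Type*) [Field k] (μ ν : kˣ)
    (σ : (MvPowerSeries (Fin 2) k ⧸ nodeIdeal k) ≃ₐ[k]
         (MvPowerSeries (Fin 2) k ⧸ nodeIdeal k))
    (hσ :
      (σ (Ideal.Quotient.mkₐ k (nodeIdeal k) (MvPowerSeries.X 0)) =
          (μ : k) • Ideal.Quotient.mkₐ k (nodeIdeal k) (MvPowerSeries.X 0) ∧
        σ (Ideal.Quotient.mkₐ k (nodeIdeal k) (MvPowerSeries.X 1)) =
          (ν : k) • Ideal.Quotient.mkₐ k (nodeIdeal k) (MvPowerSeries.X 1)) ∨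
      (σ (Ideal.Quotient.mkₐ k (nodeIdeal k) (MvPowerSeries.X 0)) =
          (μ : k) • Ideal.Quotient.mkₐ k (nodeIdeal k) (MvPowerSeries.X 1) ∧
        σ (Ideal.Quotient.mkₐ k (nodeIdeal k) (MvPowerSeries.X 1)) =
          (ν : k) • Ideal.Quotient.mkₐ k (nodeIdeal k) (MvPowerSeries.X 0))) :
    (μ : k) * ν = 1 ↔
      ∃ τ : MvPowerSeries (Fin 2) k ≃ₐ[k] MvPowerSeries (Fin 2) k,
        (∀ x : MvPowerSeries (Fin 2) k,
          Ideal.Quotient.mkₐ k (nodeIdeal k) (τ x) =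
            σ (Ideal.Quotient.mkₐ k (nodeIdeal k) x)) ∧
        τ (MvPowerSeries.X 0 * MvPowerSeries.X 1) =
          MvPowerSeries.X 0 * MvPowerSeries.X 1 := by
  have hne : (MvPowerSeries.X 0 * MvPowerSeries.X 1 : MvPowerSeries (Fin 2) k) ≠ 0 :=
    mul_ne_zero (node_X_ne_zero 0) (node_X_ne_zero 1)
  have hC : ∀ (c : k) (x : MvPowerSeries (Fin 2) k), c • x = MvPowerSeries.C c * x := fun c x => by
    rw [MvPowerSeries.smul_eq_C_mul]
  constructor
  · intro h
    have hCC : (MvPowerSeries.C (μ : k) * MvPowerSeries.C (ν : k) : MvPowerSeries (Fin 2) k) = 1 := by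
      rw [← map_mul, h, map_one]
    obtain ⟨h0, h1⟩ | ⟨h0, h1⟩ := hσ
    · obtain ⟨τ, t0, t1⟩ := node_diag μ ν
      refine ⟨τ, fun x => ?_, ?_⟩
      · refine node_hom_ext ((Ideal.Quotient.mkₐ k (nodeIdeal k)).comp τ.toAlgHom)
          (σ.toAlgHom.comp (Ideal.Quotient.mkₐ k (nodeIdeal k)))
          ((μ : k) • MvPowerSeries.X 0) ((ν : k) • MvPowerSeries.X 1)
          (by simp) (by simp) ?_ ?_ ?_ ?_ x
        · exact congrArg _ t0
        · exact congrArg _ t1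
        · exact h0
        · exact h1
      · rw [map_mul, t0, t1, hC, hC]
        linear_combination (MvPowerSeries.X 0 * MvPowerSeries.X 1) * hCC
    · obtain ⟨τ, t0, t1⟩ := node_diag ν μ
      let ρ := MvPowerSeries.renameEquiv k (Equiv.swap (0 : Fin 2) 1)
      have r0 : ρ (MvPowerSeries.X 0) = MvPowerSeries.X 1 := by
        simp [ρ, MvPowerSeries.renameEquiv]
      have r1 : ρ (MvPowerSeries.X 1) = MvPowerSeries.X 0 := by
        simp [ρ, MvPowerSeries.renameEquiv]
      have s0 : (ρ.trans τ) (MvPowerSeries.X 0) = (μ : k) • MvPowerSeries.X 1 := by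
        rw [AlgEquiv.trans_apply, r0, t1]
      have s1 : (ρ.trans τ) (MvPowerSeries.X 1) = (ν : k) • MvPowerSeries.X 0 := by
        rw [AlgEquiv.trans_apply, r1, t0]
      refine ⟨ρ.trans τ, fun x => ?_, ?_⟩
      · refine node_hom_ext ((Ideal.Quotient.mkₐ k (nodeIdeal k)).comp (ρ.trans τ).toAlgHom)
          (σ.toAlgHom.comp (Ideal.Quotient.mkₐ k (nodeIdeal k)))
          ((μ : k) • MvPowerSeries.X 1) ((ν : k) • MvPowerSeries.X 0)
          (by simp) (by simp) ?_ ?_ ?_ ?_ x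
        · exact congrArg _ s0
        · exact congrArg _ s1
        · exact h0
        · exact h1
      · rw [map_mul, s0, s1, hC, hC]
        linear_combination (MvPowerSeries.X 0 * MvPowerSeries.X 1) * hCC
  · rintro ⟨τ, hτ, hab⟩
    rw [map_mul] at hab
    obtain ⟨h0, h1⟩ | ⟨h0, h1⟩ := hσ
    · obtain ⟨f, hf⟩ := node_lift_eq _ ((μ : k) • MvPowerSeries.X 0) ((hτ (.X 0)).trans h0)
      obtain ⟨g, hg⟩ := node_lift_eq _ ((ν : k) • MvPowerSeries.X 1) ((hτ (.X 1)).trans h1)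
      rw [hf, hg, hC, hC] at hab
      have e : (MvPowerSeries.C (μ : k) + MvPowerSeries.X 1 * f) *
          (MvPowerSeries.C (ν : k) + MvPowerSeries.X 0 * g) = 1 := by
        apply mul_left_cancel₀ hne
        linear_combination hab
      simpa using congrArg MvPowerSeries.constantCoeff e
    · obtain ⟨f, hf⟩ := node_lift_eq _ ((μ : k) • MvPowerSeries.X 1) ((hτ (.X 0)).trans h0)
      obtain ⟨g, hg⟩ := node_lift_eq _ ((ν : k) • MvPowerSeries.X 0) ((hτ (.X 1)).trans h1)
      rw [hf, hg, hC, hC] at hab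
      have e : (MvPowerSeries.C (μ : k) + MvPowerSeries.X 0 * f) *
          (MvPowerSeries.C (ν : k) + MvPowerSeries.X 1 * g) = 1 := by
        apply mul_left_cancel₀ hne
        linear_combination hab
      simpa using congrArg MvPowerSeries.constantCoeff e
end
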